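/- arXiv:2508.14251 — 2 statements merged into one kernel-verified Lean document; each statement's English description precedes it below -/
import Mathlib

section
/- Fix an integer d ≥ 2. The function H is strictly monotonically decreasing on (0,∞); equivalently, the heat capacity per particle at constant pressure c_p = k_B·H(m/(k_B T)) (and likewise c_v = c_p − k_B) is strictly monotonically increasing in the temperature T. -/
open MeasureTheory Real Filter

/-- The modified Bessel function of the second kind, defined via its integral
representation `K_ν(z) = ∫_0^∞ exp(−z cosh t) cosh(ν t) dt`. -/
noncomputable def besselK (ν z : ℝ) : ℝ :=
  ∫ t in Set.Ioi (0:ℝ), Real.exp (-z * Real.cosh t) * Real.cosh (ν * t)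

/-- The ratio `G_k(z) = K_{(d+1)/2+k}(z) / K_{(d+1)/2}(z)`. -/
noncomputable def G (d k : ℤ) (z : ℝ) : ℝ :=
  besselK (((d : ℝ) + 1) / 2 + (k : ℝ)) z / besselK (((d : ℝ) + 1) / 2) z

/-- `H(z) = −z² G_1′(z)`; physically `H(z) = c_p/k_B` is the dimensionless heat
capacity per particle at constant pressure, and `H(z) − 1 = c_v/k_B`. -/
noncomputable def Hfun (d : ℤ) (z : ℝ) : ℝ := -z ^ 2 * deriv (G d 1) z

theorem integrableOn_besselK_integrand (ν : ℝ) {z : ℝ} (hz : 0 < z) :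
    IntegrableOn (fun t : ℝ => Real.exp (-z * Real.cosh t) * Real.cosh (ν * t)) (Set.Ioi 0) := by
  have hdom : IntegrableOn (fun t : ℝ => Real.exp ((|ν| + 1) ^ 2 / z) * Real.exp (-t))
      (Set.Ioi 0) := (integrableOn_exp_neg_Ioi 0).const_mul _
  refine Integrable.mono' hdom (Continuous.aestronglyMeasurable (by fun_prop)) ?_
  refine (ae_restrict_iff' measurableSet_Ioi).2 (ae_of_all _ fun t (ht : 0 < t) => ?_)
  have hcosh : t ^ 2 / 4 ≤ Real.cosh t := by
    rw [Real.cosh_eq]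
    nlinarith [Real.quadratic_le_exp_of_nonneg ht.le, Real.exp_pos (-t)]
  have hcosh_le : Real.cosh (ν * t) ≤ Real.exp (|ν| * t) := by
    rw [← Real.cosh_abs, abs_mul, abs_of_pos ht, Real.cosh_eq]
    have : Real.exp (-(|ν| * t)) ≤ Real.exp (|ν| * t) :=
      Real.exp_le_exp.2 (by nlinarith [mul_nonneg (abs_nonneg ν) ht.le])
    linarith
  rw [Real.norm_of_nonneg (by positivity)]
  calc Real.exp (-z * Real.cosh t) * Real.cosh (ν * t)
      ≤ Real.exp (-z * (t ^ 2 / 4)) * Real.exp (|ν| * t) := by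
        gcongr ?_ * ?_
        exact Real.exp_le_exp.2 (by nlinarith)
    _ ≤ Real.exp ((|ν| + 1) ^ 2 / z) * Real.exp (-t) := by
        rw [← Real.exp_add, ← Real.exp_add]
        refine Real.exp_le_exp.2 ?_
        have hsq : (|ν| + 1) ^ 2 / z + -t - (-z * (t ^ 2 / 4) + |ν| * t)
            = (z * t / 2 - (|ν| + 1)) ^ 2 / z := by
          field_simp
          ring
        have : 0 ≤ (z * t / 2 - (|ν| + 1)) ^ 2 / z := by positivity
        linarith

theorem cosh_mul_cosh_mul_eq (ν t : ℝ) :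
    Real.cosh t * Real.cosh (ν * t)
      = (Real.cosh ((ν + 1) * t) + Real.cosh ((ν - 1) * t)) / 2 := by
  rw [add_mul, sub_mul, one_mul, Real.cosh_add, Real.cosh_sub]
  ring

theorem sinh_mul_sinh_mul_eq (ν t : ℝ) :
    Real.sinh t * Real.sinh (ν * t)
      = (Real.cosh ((ν + 1) * t) - Real.cosh ((ν - 1) * t)) / 2 := by
  rw [add_mul, sub_mul, one_mul, Real.cosh_add, Real.cosh_sub]
  ring

theorem hasDerivAt_besselK (ν : ℝ) {z : ℝ} (hz : 0 < z) :
    HasDerivAt (besselK ν) (-(besselK (ν + 1) z + besselK (ν - 1) z) / 2) z := by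
  have hint : ∀ y : ℝ, 0 < y → IntegrableOn
      (fun t : ℝ => Real.exp (-y * Real.cosh t) * (Real.cosh t * Real.cosh (ν * t)))
      (Set.Ioi 0) := by
    intro y hy
    refine (((integrableOn_besselK_integrand (ν + 1) hy).add
      (integrableOn_besselK_integrand (ν - 1) hy)).div_const 2).congr (ae_of_all _ fun t => ?_)
    simp only [Pi.add_apply]
    rw [cosh_mul_cosh_mul_eq]
    ring
  have hderiv := (hasDerivAt_integral_of_dominated_loc_of_deriv_le
    (μ := volume.restrict (Set.Ioi (0 : ℝ)))
    (F := fun y t : ℝ => Real.exp (-y * Real.cosh t) * Real.cosh (ν * t))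
    (F' := fun y t : ℝ => -(Real.exp (-y * Real.cosh t) * (Real.cosh t * Real.cosh (ν * t))))
    (bound := fun t => Real.exp (-(z / 2) * Real.cosh t) * (Real.cosh t * Real.cosh (ν * t)))
    (x₀ := z) (s := Set.Ioi (z / 2)) (Ioi_mem_nhds (by linarith))
    (Eventually.of_forall fun y => Continuous.aestronglyMeasurable (by fun_prop))
    (integrableOn_besselK_integrand ν hz)
    (Continuous.aestronglyMeasurable (by fun_prop))
    (ae_of_all _ fun t y (hy : z / 2 < y) => by
      rw [norm_neg, Real.norm_of_nonneg (by positivity)]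
      gcongr)
    (hint (z / 2) (by linarith))
    (ae_of_all _ fun t y _ => by
      have h := (((hasDerivAt_id y).neg.mul_const (Real.cosh t)).exp).mul_const
        (Real.cosh (ν * t))
      refine h.congr_deriv ?_
      simp only [Pi.neg_apply, id]
      ring)).2
  refine hderiv.congr_deriv ?_
  unfold besselK
  rw [← integral_add (integrableOn_besselK_integrand _ hz) (integrableOn_besselK_integrand _ hz),
    ← integral_neg, ← integral_div]
  refine integral_congr_ae (ae_of_all _ fun t => ?_)
  simp only []
  rw [cosh_mul_cosh_mul_eq]
  ring

theorem besselK_add_one_sub (ν : ℝ) {z : ℝ} (hz : 0 < z) :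
    z * (besselK (ν + 1) z - besselK (ν - 1) z) = 2 * ν * besselK ν z := by
  have i1 := integrableOn_besselK_integrand (ν + 1) hz
  have i2 := integrableOn_besselK_integrand (ν - 1) hz
  have i3 := integrableOn_besselK_integrand ν hz
  have hderiv : ∀ t : ℝ, HasDerivAt (fun t : ℝ => Real.exp (-z * Real.cosh t) * Real.sinh (ν * t))
      (ν * (Real.exp (-z * Real.cosh t) * Real.cosh (ν * t))
        - z / 2 * (Real.exp (-z * Real.cosh t) * Real.cosh ((ν + 1) * t)
          - Real.exp (-z * Real.cosh t) * Real.cosh ((ν - 1) * t))) t := by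
    intro t
    have h := (((Real.hasDerivAt_cosh t).const_mul (-z)).exp).mul
      (((hasDerivAt_id t).const_mul ν).sinh)
    refine h.congr_deriv ?_
    have hs := sinh_mul_sinh_mul_eq ν t
    simp only [id]
    linear_combination (-z * Real.exp (-z * Real.cosh t)) * hs
  have i12 : IntegrableOn (fun t : ℝ => z / 2 * (Real.exp (-z * Real.cosh t)
      * Real.cosh ((ν + 1) * t) - Real.exp (-z * Real.cosh t) * Real.cosh ((ν - 1) * t)))
      (Set.Ioi 0) := (i1.sub i2).const_mul (z / 2)
  have hint := (i3.const_mul ν).sub i12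
  have hlim : Tendsto (fun t : ℝ => Real.exp (-z * Real.cosh t) * Real.sinh (ν * t))
      atTop (nhds 0) := by
    refine tendsto_zero_of_hasDerivAt_of_integrableOn_Ioi (a := 0) (fun t _ => hderiv t) hint ?_
    refine Integrable.mono' i3 (Continuous.aestronglyMeasurable (by fun_prop))
      (ae_of_all _ fun t => ?_)
    rw [norm_mul, Real.norm_of_nonneg (Real.exp_pos _).le, Real.norm_eq_abs]
    gcongr
    have h := Real.sinh_lt_cosh (-(ν * t))
    rw [Real.sinh_neg, Real.cosh_neg] at h
    exact abs_le.2 ⟨by linarith, (Real.sinh_lt_cosh _).le⟩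
  have key := integral_Ioi_of_hasDerivAt_of_tendsto' (a := 0) (fun t _ => hderiv t) hint hlim
  rw [integral_sub (i3.const_mul ν) i12, integral_const_mul, integral_const_mul,
    integral_sub i1 i2] at key
  simp only [mul_zero, Real.sinh_zero, sub_zero] at key
  unfold besselK
  linarith

theorem besselK_pos (ν : ℝ) {z : ℝ} (hz : 0 < z) : 0 < besselK ν z := by
  unfold besselK
  rw [setIntegral_pos_iff_support_of_nonneg_ae (ae_of_all _ fun t => by positivity)
    (integrableOn_besselK_integrand ν hz)]
  have : Function.support (fun t : ℝ => Real.exp (-z * Real.cosh t) * Real.cosh (ν * t))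
      = Set.univ := Set.eq_univ_of_forall fun t => by
    rw [Function.mem_support]
    positivity
  rw [this, Set.univ_inter]
  simp

theorem besselK_le_besselK {μ ν z : ℝ} (hz : 0 < z) (h : |μ| ≤ |ν|) :
    besselK μ z ≤ besselK ν z := by
  refine integral_mono (integrableOn_besselK_integrand μ hz)
    (integrableOn_besselK_integrand ν hz) fun t => ?_
  have : Real.cosh (μ * t) ≤ Real.cosh (ν * t) := by
    rw [Real.cosh_le_cosh, abs_mul, abs_mul]
    gcongr
  simp only []
  gcongr

theorem besselK_le_exp_mul (ν : ℝ) {z : ℝ} (hz : 1 ≤ z) :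
    besselK ν z ≤ Real.exp (1 - z) * besselK ν 1 := by
  unfold besselK
  rw [← integral_const_mul]
  refine integral_mono (integrableOn_besselK_integrand ν (by linarith))
    ((integrableOn_besselK_integrand ν one_pos).const_mul _) fun t => ?_
  simp only []
  rw [← mul_assoc, ← Real.exp_add]
  gcongr
  nlinarith [Real.one_le_cosh t]

theorem tendsto_pow_mul_besselK (n : ℕ) (ν : ℝ) :
    Tendsto (fun z => z ^ n * besselK ν z) atTop (nhds 0) := by
  have h := (Real.tendsto_pow_mul_exp_neg_atTop_nhds_zero n).const_mul
    (Real.exp 1 * besselK ν 1)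
  rw [mul_zero] at h
  refine tendsto_of_tendsto_of_tendsto_of_le_of_le' tendsto_const_nhds h ?_ ?_
  · filter_upwards [eventually_ge_atTop 1] with z hz
    have := besselK_pos ν (z := z) (by linarith)
    positivity
  · filter_upwards [eventually_ge_atTop 1] with z hz
    have := besselK_le_exp_mul ν hz
    rw [sub_eq_add_neg, Real.exp_add] at this
    calc z ^ n * besselK ν z ≤ z ^ n * (Real.exp 1 * Real.exp (-z) * besselK ν 1) := by gcongr
      _ = _ := by ring

/-- A function with negative derivative on `(0, ∞)` which is asymptotically bounded below by a
function tending to `0` is positive. -/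
theorem pos_of_hasDerivAt_neg {f f' ψ : ℝ → ℝ} (hf : ∀ z, 0 < z → HasDerivAt f (f' z) z)
    (hf' : ∀ z, 0 < z → f' z < 0) (hψ : Tendsto ψ atTop (nhds 0))
    (hle : ∀ z, 1 ≤ z → ψ z ≤ f z) {z : ℝ} (hz : 0 < z) : 0 < f z := by
  have hanti : StrictAntiOn f (Set.Ioi 0) := by
    refine strictAntiOn_of_deriv_neg (convex_Ioi 0)
      (fun x hx => (hf x hx).continuousAt.continuousWithinAt) fun x hx => ?_
    rw [interior_Ioi] at hx
    rw [(hf x hx).deriv]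
    exact hf' x hx
  have hlt : f (z + 1) < f z := hanti hz (show (0 : ℝ) < z + 1 by linarith) (by linarith)
  have hnonneg : 0 ≤ f (z + 1) := by
    refine le_of_tendsto hψ ?_
    filter_upwards [eventually_ge_atTop (z + 1)] with x hx
    refine (hle x (by linarith)).trans ?_
    exact hanti.antitoneOn (show (0 : ℝ) < z + 1 by linarith)
      (show (0 : ℝ) < x by linarith) hx
  linarith

/-- The function `z K_{ν-1}(z) / K_ν(z)`. -/
noncomputable def besselRatio (ν z : ℝ) : ℝ := z * besselK (ν - 1) z / besselK ν z

theorem hasDerivAt_besselK' (ν : ℝ) {z : ℝ} (hz : 0 < z) :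
    HasDerivAt (besselK ν) (-((besselRatio ν z + ν) / z) * besselK ν z) z := by
  refine (hasDerivAt_besselK ν hz).congr_deriv ?_
  have h := besselK_add_one_sub ν hz
  have hA := (besselK_pos ν hz).ne'
  unfold besselRatio
  field_simp
  linear_combination (-1 : ℝ) * h

theorem hasDerivAt_besselRatio (ν : ℝ) {z : ℝ} (hz : 0 < z) :
    HasDerivAt (besselRatio ν)
      ((besselRatio ν z ^ 2 + 2 * ν * besselRatio ν z - z ^ 2) / z) z := by
  have hA := (besselK_pos ν hz).ne'
  have h := ((hasDerivAt_id z).mul (hasDerivAt_besselK (ν - 1) hz)).div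
    (hasDerivAt_besselK' ν hz) hA
  refine h.congr_deriv ?_
  have hrec := besselK_add_one_sub (ν - 1) hz
  rw [sub_add_cancel] at hrec ⊢
  unfold besselRatio
  simp only [Pi.mul_apply, id]
  field_simp
  linear_combination (besselK ν z) * hrec

section

variable {ν z : ℝ}

theorem besselRatio_nonneg (hz : 0 < z) : 0 ≤ besselRatio ν z := by
  have := besselK_pos ν hz
  have := besselK_pos (ν - 1) hz
  unfold besselRatio
  positivity

theorem besselRatio_le (hν : 1 / 2 ≤ ν) (hz : 0 < z) : besselRatio ν z ≤ z := by
  unfold besselRatio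
  rw [div_le_iff₀ (besselK_pos ν hz)]
  gcongr
  exact besselK_le_besselK hz (abs_le_abs (by linarith) (by linarith))

theorem tendsto_mul_pow_mul_besselK_sq (c : ℝ) (n : ℕ) (ν : ℝ) :
    Tendsto (fun z => c * (z ^ n * besselK ν z ^ 2)) atTop (nhds 0) := by
  have h := ((tendsto_pow_mul_besselK n ν).mul (tendsto_pow_mul_besselK 0 ν)).const_mul c
  simp only [mul_zero] at h
  refine h.congr fun z => ?_
  ring

/-- The derivative of `K_ν ^ 2 * p`, used with `K_ν ^ 2` as an integrating factor. -/
theorem hasDerivAt_besselK_sq_mul (hz : 0 < z) {p : ℝ → ℝ} {p' : ℝ} (hp : HasDerivAt p p' z) :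
    HasDerivAt (fun y => besselK ν y ^ 2 * p y)
      (besselK ν z ^ 2 * (p' - 2 * (besselRatio ν z + ν) / z * p z)) z := by
  refine (((hasDerivAt_besselK' ν hz).pow 2).mul hp).congr_deriv ?_
  simp only [Pi.pow_apply]
  push_cast
  ring

/-- The derivative of `z (z K_{ν-1} / K_ν)'`, rewritten through the Riccati equation. -/
theorem hasDerivAt_besselRatio_riccati (hz : 0 < z) :
    HasDerivAt (fun y => besselRatio ν y ^ 2 + 2 * ν * besselRatio ν y - y ^ 2)
      ((2 * besselRatio ν z + 2 * ν)
        * ((besselRatio ν z ^ 2 + 2 * ν * besselRatio ν z - z ^ 2) / z) - 2 * z) z := by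
  have hw := hasDerivAt_besselRatio ν hz
  refine (((hw.pow 2).add (hw.const_mul (2 * ν))).sub ((hasDerivAt_id z).pow 2)).congr_deriv ?_
  simp only [id]
  push_cast
  ring

/-- `z K_{ν-1} / K_ν` is increasing: the numerator of its derivative is positive. -/
theorem besselRatio_deriv_pos (hν : 0 ≤ ν) (hz : 0 < z) :
    0 < besselRatio ν z ^ 2 + 2 * ν * besselRatio ν z - z ^ 2 := by
  refine pos_of_mul_pos_right (a := besselK ν z ^ 2) ?_ (sq_nonneg _)
  refine pos_of_hasDerivAt_neg
    (fun y hy => hasDerivAt_besselK_sq_mul hy (hasDerivAt_besselRatio_riccati hy)) (fun y hy => ?_)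
    (tendsto_mul_pow_mul_besselK_sq (-1) 2 ν) (fun y hy => ?_) hz
  · have hA := besselK_pos ν hy
    refine mul_neg_of_pos_of_neg (by positivity) ?_
    have : (2 * besselRatio ν y + 2 * ν)
        * ((besselRatio ν y ^ 2 + 2 * ν * besselRatio ν y - y ^ 2) / y) - 2 * y
        - 2 * (besselRatio ν y + ν) / y
          * (besselRatio ν y ^ 2 + 2 * ν * besselRatio ν y - y ^ 2) = -(2 * y) := by
      ring
    rw [this]
    linarith
  · have hw := besselRatio_nonneg (ν := ν) (show 0 < y by linarith)
    have : 0 ≤ besselK ν y ^ 2 * (besselRatio ν y ^ 2 + 2 * ν * besselRatio ν y) := by positivity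
    linarith

theorem sub_lt_besselRatio (hν : 1 / 2 < ν) (hz : 0 < z) :
    z - (ν - 1 / 2) < besselRatio ν z := by
  suffices h : 0 < Real.exp (-z) * besselK ν z / √z * (besselRatio ν z - z + (ν - 1 / 2)) by
    have hA := besselK_pos ν hz
    have := pos_of_mul_pos_right h (by positivity)
    linarith
  refine pos_of_hasDerivAt_neg
    (f := fun y => Real.exp (-y) * besselK ν y / √y * (besselRatio ν y - y + (ν - 1 / 2)))
    (f' := fun y => Real.exp (-y) * besselK ν y / √y * (-(ν ^ 2 - 1 / 4) / y))
    (ψ := fun y => -1 * (y ^ 1 * besselK ν y))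
    (fun y hy => ?_) (fun y hy => ?_) ?_ (fun y hy => ?_) hz
  · have hs : √y ≠ 0 := (Real.sqrt_pos.2 hy).ne'
    have h := ((((hasDerivAt_id y).neg.exp).mul (hasDerivAt_besselK' ν hy)).div
      ((hasDerivAt_id y).sqrt hy.ne') hs).mul
      (((hasDerivAt_besselRatio ν hy).sub (hasDerivAt_id y)).add_const (ν - 1 / 2))
    refine h.congr_deriv ?_
    simp only [Pi.neg_apply, Pi.mul_apply, Pi.div_apply, Pi.sub_apply, id]
    have hsq : √y ^ 2 = y := Real.sq_sqrt hy.le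
    generalize √y = s at *
    subst hsq
    field_simp
    ring
  · have hA := besselK_pos ν hy
    refine mul_neg_of_pos_of_neg (by positivity) (div_neg_of_neg_of_pos ?_ hy)
    nlinarith
  · simpa using (tendsto_pow_mul_besselK 1 ν).const_mul (-1)
  · have hy0 : 0 < y := by linarith
    have hA := besselK_pos ν hy0
    have hw := besselRatio_nonneg (ν := ν) hy0
    have hs : 1 ≤ √y := Real.one_le_sqrt.2 hy
    have he : Real.exp (-y) ≤ 1 := Real.exp_le_one_iff.2 (by linarith)
    have hle : Real.exp (-y) * besselK ν y / √y ≤ besselK ν y := by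
      rw [div_le_iff₀ (by positivity)]
      nlinarith [mul_le_mul_of_nonneg_right he hA.le, mul_le_mul_of_nonneg_left hs hA.le]
    have hnonneg : 0 ≤ Real.exp (-y) * besselK ν y / √y := by positivity
    nlinarith [mul_le_mul_of_nonneg_right hle hy0.le,
      mul_nonneg hnonneg (show 0 ≤ besselRatio ν y + (ν - 1 / 2) by linarith)]

theorem besselRatio_deriv_lt_one (hν : 1 / 2 < ν) (hz : 0 < z) :
    besselRatio ν z ^ 2 + 2 * ν * besselRatio ν z - z ^ 2 < z := by
  suffices h : 0 < z - (besselRatio ν z ^ 2 + 2 * ν * besselRatio ν z - z ^ 2) by linarith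
  refine pos_of_mul_pos_right (a := besselK ν z ^ 2) ?_ (sq_nonneg _)
  refine pos_of_hasDerivAt_neg
    (fun y hy => hasDerivAt_besselK_sq_mul hy
      ((hasDerivAt_id y).sub (hasDerivAt_besselRatio_riccati hy))) (fun y hy => ?_)
    (tendsto_mul_pow_mul_besselK_sq (-(2 * ν)) 1 ν) (fun y hy => ?_) hz
  · have hA := besselK_pos ν hy
    refine mul_neg_of_pos_of_neg (by positivity) ?_
    have hlt := sub_lt_besselRatio hν hy
    simp only [Pi.sub_apply, id]
    have : 1 - ((2 * besselRatio ν y + 2 * ν)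
        * ((besselRatio ν y ^ 2 + 2 * ν * besselRatio ν y - y ^ 2) / y) - 2 * y)
        - 2 * (besselRatio ν y + ν) / y
          * (y - (besselRatio ν y ^ 2 + 2 * ν * besselRatio ν y - y ^ 2))
        = 2 * (y - (ν - 1 / 2) - besselRatio ν y) := by
      field_simp
      ring
    rw [this]
    linarith
  · have hy0 : 0 < y := by linarith
    have hA := besselK_pos ν hy0
    have hw := besselRatio_nonneg (ν := ν) hy0
    have hwy := besselRatio_le hν.le hy0
    have hν0 : 0 < ν := by linarith
    simp only [Pi.sub_apply, id]
    have : -(2 * ν) * y ≤ y - (besselRatio ν y ^ 2 + 2 * ν * besselRatio ν y - y ^ 2) := by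
      nlinarith [mul_le_mul_of_nonneg_left hwy hν0.le]
    nlinarith [mul_le_mul_of_nonneg_left this (sq_nonneg (besselK ν y))]

/-- `z K_{ν-1} / K_ν` is strictly convex: `z ^ 2` times its second derivative is positive. -/
theorem besselRatio_deriv2_pos (hν : 1 / 2 < ν) (hz : 0 < z) :
    0 < (besselRatio ν z ^ 2 + 2 * ν * besselRatio ν z - z ^ 2)
        * (2 * besselRatio ν z + 2 * ν - 1) - 2 * z ^ 2 := by
  refine pos_of_mul_pos_right (a := besselK ν z ^ 2) ?_ (sq_nonneg _)
  refine pos_of_hasDerivAt_neg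
    (fun y hy => hasDerivAt_besselK_sq_mul hy
      (((hasDerivAt_besselRatio_riccati hy).mul
        ((((hasDerivAt_besselRatio ν hy).const_mul 2).add_const (2 * ν)).sub_const 1)).sub
        (((hasDerivAt_id y).pow 2).const_mul 2))) (fun y hy => ?_)
    (tendsto_mul_pow_mul_besselK_sq (-2) 2 ν) (fun y hy => ?_) hz
  · have hA := besselK_pos ν hy
    refine mul_neg_of_pos_of_neg (by positivity) ?_
    have hpos := besselRatio_deriv_pos (ν := ν) (by linarith) hy
    have hlt := besselRatio_deriv_lt_one hν hy
    simp only [Pi.sub_apply, Pi.mul_apply, Pi.pow_apply, id]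
    set w := besselRatio ν y
    set q := w ^ 2 + 2 * ν * w - y ^ 2
    have : q ^ 2 / y < y := by
      rw [div_lt_iff₀ hy]
      nlinarith
    refine lt_of_eq_of_lt (b := 2 * (q ^ 2 / y - y)) ?_ (by linarith)
    push_cast
    field_simp
    ring
  · have hy0 : 0 < y := by linarith
    have hw := besselRatio_nonneg (ν := ν) hy0
    have hpos := besselRatio_deriv_pos (ν := ν) (by linarith) hy0
    simp only [Pi.sub_apply, Pi.mul_apply, Pi.pow_apply, id]
    nlinarith [mul_nonneg (sq_nonneg (besselK ν y)) (mul_nonneg hpos.le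
      (show 0 ≤ 2 * besselRatio ν y + 2 * ν - 1 by linarith))]

end

theorem Hfun_eq_besselRatio (d : ℤ) {z : ℝ} (hz : 0 < z) :
    Hfun d z = besselRatio (((d : ℝ) + 1) / 2) z + 2 * (((d : ℝ) + 1) / 2)
      - (besselRatio (((d : ℝ) + 1) / 2) z ^ 2
        + 2 * (((d : ℝ) + 1) / 2) * besselRatio (((d : ℝ) + 1) / 2) z - z ^ 2) := by
  have hG : ∀ y : ℝ, 0 < y →
      G d 1 y = (besselRatio (((d : ℝ) + 1) / 2) y + 2 * (((d : ℝ) + 1) / 2)) / y := by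
    intro y hy
    have hrec := besselK_add_one_sub (((d : ℝ) + 1) / 2) hy
    have hA := (besselK_pos (((d : ℝ) + 1) / 2) hy).ne'
    unfold G besselRatio
    rw [Int.cast_one]
    generalize ((d : ℝ) + 1) / 2 = ν at *
    field_simp
    linarith
  have hderiv := (((hasDerivAt_besselRatio (((d : ℝ) + 1) / 2) hz).add_const
    (2 * (((d : ℝ) + 1) / 2))).div (hasDerivAt_id z) hz.ne').congr_of_eventuallyEq
    (Filter.eventually_of_mem (Ioi_mem_nhds hz) hG)
  unfold Hfun
  rw [hderiv.deriv]
  generalize ((d : ℝ) + 1) / 2 = ν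
  simp only [id]
  field_simp
  ring

theorem strictAntiOn_Hfun {d : ℤ} (hd : 2 ≤ d) : StrictAntiOn (Hfun d) (Set.Ioi 0) := by
  have hν : 1 / 2 < ((d : ℝ) + 1) / 2 := by
    have : (2 : ℝ) ≤ d := by exact_mod_cast hd
    linarith
  have hderiv : ∀ z : ℝ, 0 < z → ∃ c < 0, HasDerivAt (Hfun d) c z := by
    intro z hz
    have h := (((hasDerivAt_besselRatio (((d : ℝ) + 1) / 2) hz).add_const
      (2 * (((d : ℝ) + 1) / 2))).sub (hasDerivAt_besselRatio_riccati hz)).congr_of_eventuallyEq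
      (Filter.eventually_of_mem (Ioi_mem_nhds hz) fun y hy => Hfun_eq_besselRatio d hy)
    refine ⟨_, ?_, h⟩
    have hpos := div_pos (besselRatio_deriv2_pos hν hz) hz
    generalize ((d : ℝ) + 1) / 2 = ν at *
    refine lt_of_eq_of_lt ?_ (neg_neg_of_pos hpos)
    field_simp
    ring
  refine strictAntiOn_of_deriv_neg (convex_Ioi 0) (fun z hz => ?_) fun z hz => ?_
  · obtain ⟨c, -, h⟩ := hderiv z hz
    exact h.continuousAt.continuousWithinAt
  · rw [interior_Ioi] at hz
    obtain ⟨c, hc, h⟩ := hderiv z hz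
    rwa [h.deriv]

/-- `H` is strictly monotonically decreasing on `(0,∞)`; equivalently, the heat
capacity `c_p = k_B H(m/(k_B T))` is strictly monotonically increasing in `T`. -/
theorem Hfun_strictAnti (d : ℤ) (hd : 2 ≤ d) :
    StrictAntiOn (Hfun d) (Set.Ioi 0) ∧
    ∀ m kB : ℝ, 0 < m → 0 < kB →
      StrictMonoOn (fun T : ℝ => kB * Hfun d (m / (kB * T))) (Set.Ioi 0) := by
  refine ⟨strictAntiOn_Hfun hd, fun m kB hm hkB T₁ hT₁ T₂ hT₂ hlt => ?_⟩
  rw [Set.mem_Ioi] at hT₁ hT₂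
  have hanti : Hfun d (m / (kB * T₁)) < Hfun d (m / (kB * T₂)) :=
    strictAntiOn_Hfun hd (Set.mem_Ioi.2 (by positivity)) (Set.mem_Ioi.2 (by positivity)) (by gcongr)
  exact mul_lt_mul_of_pos_left hanti hkB
end

section
/- Fix an integer d ≥ 2. For every z > 0 one has the identity G_1(z) + z·G_1′(z) = G_{−1}(z) + z·G_{−1}′(z), and this common value is strictly positive. -/
open MeasureTheory Real Filter

theorem sq_div_two_le_cosh (t : ℝ) : t ^ 2 / 2 ≤ Real.cosh t := by
  have h1 : Real.cosh t = 1 + 2 * Real.sinh (t / 2) ^ 2 := by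
    have h := Real.cosh_two_mul (t / 2)
    rw [mul_div_cancel₀ t two_ne_zero, Real.cosh_sq] at h
    linarith
  have h2 : (t / 2) ^ 2 ≤ Real.sinh (t / 2) ^ 2 := by
    rw [sq_le_sq, Real.abs_sinh]
    exact Real.self_le_sinh_iff.2 (abs_nonneg _)
  nlinarith

/-- The Bessel kernel decays at least exponentially. -/
theorem exp_neg_mul_cosh_mul_cosh_le {z : ℝ} (hz : 0 < z) (ν : ℝ) {t : ℝ} (ht : 0 ≤ t) :
    Real.exp (-z * Real.cosh t) * Real.cosh (ν * t) ≤
      Real.exp ((|ν| + 1) ^ 2 / (2 * z)) * Real.exp (-t) := by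
  have h1 : Real.cosh (ν * t) ≤ Real.exp (|ν| * t) := by
    rw [← Real.cosh_abs, abs_mul, abs_of_nonneg ht, Real.cosh_eq]
    have : Real.exp (-(|ν| * t)) ≤ Real.exp (|ν| * t) :=
      Real.exp_le_exp.2 (by nlinarith [mul_nonneg (abs_nonneg ν) ht])
    linarith
  have h2 : -z * Real.cosh t + |ν| * t ≤ (|ν| + 1) ^ 2 / (2 * z) + -t := by
    have h3 : z * (t ^ 2 / 2) - (|ν| + 1) * t + (|ν| + 1) ^ 2 / (2 * z) =
        (z * t - (|ν| + 1)) ^ 2 / (2 * z) := by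
      field_simp
      ring
    have h4 : 0 ≤ (z * t - (|ν| + 1)) ^ 2 / (2 * z) := by positivity
    nlinarith [mul_le_mul_of_nonneg_left (sq_div_two_le_cosh t) hz.le]
  calc Real.exp (-z * Real.cosh t) * Real.cosh (ν * t)
      ≤ Real.exp (-z * Real.cosh t) * Real.exp (|ν| * t) := by gcongr
    _ ≤ _ := by
      rw [← Real.exp_add, ← Real.exp_add]
      exact Real.exp_le_exp.2 h2

theorem integrableOn_besselK {z : ℝ} (hz : 0 < z) (ν : ℝ) :
    IntegrableOn (fun t => Real.exp (-z * Real.cosh t) * Real.cosh (ν * t)) (Set.Ioi 0) := by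
  refine Integrable.mono'
    ((integrableOn_exp_neg_Ioi 0).const_mul (Real.exp ((|ν| + 1) ^ 2 / (2 * z))))
    (by fun_prop) ?_
  refine (ae_restrict_iff' measurableSet_Ioi).2 (Eventually.of_forall fun t ht => ?_)
  rw [Real.norm_of_nonneg (mul_nonneg (Real.exp_pos _).le (Real.cosh_pos _).le)]
  exact exp_neg_mul_cosh_mul_cosh_le hz ν (le_of_lt ht)

theorem setIntegral_Ioi_pos {f : ℝ → ℝ} (hf : IntegrableOn f (Set.Ioi 0))
    (hpos : ∀ t, 0 < t → 0 < f t) : 0 < ∫ t in Set.Ioi (0 : ℝ), f t := by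
  have h0 : 0 ≤ᵐ[volume.restrict (Set.Ioi (0 : ℝ))] f :=
    (ae_restrict_iff' measurableSet_Ioi).2 (Eventually.of_forall fun t ht => (hpos t ht).le)
  rw [setIntegral_pos_iff_support_of_nonneg_ae h0 hf]
  have : Set.Ioi (0 : ℝ) ⊆ Function.support f ∩ Set.Ioi 0 := fun t ht => ⟨(hpos t ht).ne', ht⟩
  exact lt_of_lt_of_le (by simp) (measure_mono this)

theorem cosh_add_one_mul (ν t : ℝ) :
    Real.cosh ((ν + 1) * t) =
      Real.cosh (ν * t) * Real.cosh t + Real.sinh (ν * t) * Real.sinh t := by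
  rw [add_mul, one_mul, Real.cosh_add]

theorem cosh_sub_one_mul (ν t : ℝ) :
    Real.cosh ((ν - 1) * t) =
      Real.cosh (ν * t) * Real.cosh t - Real.sinh (ν * t) * Real.sinh t := by
  rw [sub_mul, one_mul, Real.cosh_sub]

/-- The three-term recurrence in the order. -/
theorem besselK_recurrence (ν : ℝ) {z : ℝ} (hz : 0 < z) :
    z * besselK (ν + 1) z = z * besselK (ν - 1) z + 2 * ν * besselK ν z := by
  have hp := integrableOn_besselK hz (ν + 1)
  have hm := integrableOn_besselK hz (ν - 1)
  have h0 := integrableOn_besselK hz ν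
  have hderiv : ∀ t ∈ Set.Ici (0 : ℝ),
      HasDerivAt (fun t => Real.exp (-z * Real.cosh t) * Real.sinh (ν * t))
        (ν * (Real.exp (-z * Real.cosh t) * Real.cosh (ν * t)) -
          z / 2 * (Real.exp (-z * Real.cosh t) * Real.cosh ((ν + 1) * t) -
            Real.exp (-z * Real.cosh t) * Real.cosh ((ν - 1) * t))) t := by
    intro t _
    have h1 := ((Real.hasDerivAt_cosh t).const_mul (-z)).exp
    have h2 := ((hasDerivAt_id t).const_mul ν).sinh
    refine (h1.mul h2).congr_deriv ?_
    rw [cosh_add_one_mul, cosh_sub_one_mul]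
    simp only [id]
    ring
  have hlim : Tendsto (fun t => Real.exp (-z * Real.cosh t) * Real.sinh (ν * t)) atTop
      (nhds 0) := by
    have h1 : Tendsto (fun t : ℝ => Real.exp ((|ν| + 1) ^ 2 / (2 * z)) * Real.exp (-t)) atTop
        (nhds 0) := by
      simpa using Real.tendsto_exp_neg_atTop_nhds_zero.const_mul
        (Real.exp ((|ν| + 1) ^ 2 / (2 * z)))
    refine squeeze_zero_norm' ?_ h1
    filter_upwards [eventually_ge_atTop 0] with t ht
    refine le_trans ?_ (exp_neg_mul_cosh_mul_cosh_le hz ν ht)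
    rw [norm_mul, Real.norm_of_nonneg (Real.exp_pos _).le, Real.norm_eq_abs, Real.abs_sinh,
      ← Real.cosh_abs (ν * t)]
    gcongr
    exact (Real.sinh_lt_cosh _).le
  have hpm : IntegrableOn (fun t => Real.exp (-z * Real.cosh t) * Real.cosh ((ν + 1) * t) -
      Real.exp (-z * Real.cosh t) * Real.cosh ((ν - 1) * t)) (Set.Ioi 0) := hp.sub hm
  have key := integral_Ioi_of_hasDerivAt_of_tendsto' hderiv
    ((h0.const_mul ν).sub (hpm.const_mul (z / 2))) hlim
  rw [integral_sub (h0.const_mul ν) (hpm.const_mul (z / 2)), integral_const_mul,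
    integral_const_mul, integral_sub hp hm] at key
  simp only [mul_zero, Real.sinh_zero, sub_zero] at key
  simp only [besselK]
  linarith

/-- The Turán inequality: `besselK` is strictly log-convex in the order, with unit steps. -/
theorem besselK_sq_lt (ν : ℝ) {z : ℝ} (hz : 0 < z) :
    besselK ν z ^ 2 < besselK (ν - 1) z * besselK (ν + 1) z := by
  have hp := integrableOn_besselK hz (ν + 1)
  have hm := integrableOn_besselK hz (ν - 1)
  have h0 := integrableOn_besselK hz ν
  have hquad : ∀ a : ℝ,
      0 < besselK (ν + 1) z - 2 * a * besselK ν z + a ^ 2 * besselK (ν - 1) z := by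
    intro a
    have hp0 : IntegrableOn (fun t => Real.exp (-z * Real.cosh t) * Real.cosh ((ν + 1) * t) -
        2 * a * (Real.exp (-z * Real.cosh t) * Real.cosh (ν * t))) (Set.Ioi 0) :=
      hp.sub (h0.const_mul (2 * a))
    have hint := hp0.add (hm.const_mul (a ^ 2))
    have hpos := setIntegral_Ioi_pos hint fun t ht => by
      have hsym : Real.cosh ((ν + 1) * t) - 2 * a * Real.cosh (ν * t) +
          a ^ 2 * Real.cosh ((ν - 1) * t) =
          (Real.exp ((ν - 1) * t) * (Real.exp t - a) ^ 2 +
            Real.exp (-((ν - 1) * t)) * (Real.exp (-t) - a) ^ 2) / 2 := by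
        have e1 : (ν + 1) * t = (ν - 1) * t + t + t := by ring
        have e2 : ν * t = (ν - 1) * t + t := by ring
        rw [e1, e2]
        simp only [Real.cosh_eq, neg_add, Real.exp_add]
        ring
      have hlt : Real.exp (-t) < Real.exp t := Real.exp_lt_exp.2 (by linarith)
      have hsum : 0 < Real.exp ((ν - 1) * t) * (Real.exp t - a) ^ 2 +
          Real.exp (-((ν - 1) * t)) * (Real.exp (-t) - a) ^ 2 := by
        rcases eq_or_ne (Real.exp t) a with h | h
        · have : Real.exp (-t) - a ≠ 0 := by rw [← h]; exact (sub_neg.2 hlt).ne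
          positivity
        · have : Real.exp t - a ≠ 0 := sub_ne_zero.2 h
          positivity
      have hmul := mul_pos (Real.exp_pos (-z * Real.cosh t)) (half_pos hsum)
      rw [← hsym] at hmul
      simp only [Pi.add_apply]
      linarith
    simp only [Pi.add_apply] at hpos
    rw [integral_add hp0 (hm.const_mul (a ^ 2)),
      integral_sub hp (h0.const_mul (2 * a)), integral_const_mul, integral_const_mul] at hpos
    exact hpos
  have hK := besselK_pos (ν - 1) hz
  have h := mul_pos hK (hquad (besselK ν z / besselK (ν - 1) z))
  have e : besselK (ν - 1) z * (besselK (ν + 1) z -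
      2 * (besselK ν z / besselK (ν - 1) z) * besselK ν z +
      (besselK ν z / besselK (ν - 1) z) ^ 2 * besselK (ν - 1) z) =
      besselK (ν - 1) z * besselK (ν + 1) z - besselK ν z ^ 2 := by
    field_simp
    ring
  linarith

theorem hasDerivAt_G_neg_one (d : ℤ) {z : ℝ} (hz : 0 < z) :
    HasDerivAt (G d (-1)) (G d (-1) z ^ 2 + d / z * G d (-1) z - 1) z := by
  obtain ⟨ν, hν⟩ : ∃ ν : ℝ, ((d : ℝ) + 1) / 2 = ν := ⟨_, rfl⟩
  have hd : (d : ℝ) = 2 * ν - 1 := by linarith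
  have hG : G d (-1) = fun x => besselK (ν - 1) x / besselK ν x := by
    ext x
    simp [G, hν, sub_eq_add_neg]
  have h0 := (besselK_pos ν hz).ne'
  have hr := besselK_recurrence ν hz
  have hr' := besselK_recurrence (ν - 1) hz
  rw [sub_add_cancel] at hr'
  have hd1 := hasDerivAt_besselK (ν - 1) hz
  rw [sub_add_cancel] at hd1
  rw [hG]
  refine (hd1.div (hasDerivAt_besselK ν hz) h0).congr_deriv ?_
  have e1 : besselK (ν + 1) z = besselK (ν - 1) z + 2 * ν * besselK ν z / z := by
    field_simp
    linarith
  have e2 : besselK (ν - 1 - 1) z = besselK ν z - 2 * (ν - 1) * besselK (ν - 1) z / z := by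
    field_simp
    linarith
  rw [e1, e2, hd]
  field_simp
  ring

theorem G_one_eq (d : ℤ) {z : ℝ} (hz : 0 < z) : G d 1 z = G d (-1) z + (d + 1) / z := by
  have h0 := (besselK_pos (((d : ℝ) + 1) / 2) hz).ne'
  have hr := besselK_recurrence (((d : ℝ) + 1) / 2) hz
  simp only [G, Int.cast_one, Int.cast_neg, ← sub_eq_add_neg]
  field_simp at hr ⊢
  linarith

/-- For every `z > 0`, `G_1(z) + z G_1′(z) = G_{−1}(z) + z G_{−1}′(z)`, and this
common value is strictly positive. -/
theorem G_one_neg_one_identity (d : ℤ) (hd : 2 ≤ d) (z : ℝ) (hz : 0 < z) :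
    G d 1 z + z * deriv (G d 1) z = G d (-1) z + z * deriv (G d (-1)) z ∧
    0 < G d (-1) z + z * deriv (G d (-1)) z := by
  have hm := hasDerivAt_G_neg_one d hz
  have hp : HasDerivAt (G d 1)
      (G d (-1) z ^ 2 + d / z * G d (-1) z - 1 + (d + 1) * -(z ^ 2)⁻¹) z := by
    refine (hm.add ((hasDerivAt_inv hz.ne').const_mul ((d : ℝ) + 1))).congr_of_eventuallyEq ?_
    filter_upwards [Ioi_mem_nhds hz] with x hx
    rw [G_one_eq d hx, div_eq_mul_inv]
    rfl
  rw [hm.deriv, hp.deriv, G_one_eq d hz]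
  refine ⟨by field_simp; ring, ?_⟩
  have hK := besselK_pos (((d : ℝ) + 1) / 2) hz
  have hr := besselK_recurrence (((d : ℝ) + 1) / 2) hz
  have hturan := besselK_sq_lt (((d : ℝ) + 1) / 2) hz
  have hG : G d (-1) z =
      besselK (((d : ℝ) + 1) / 2 - 1) z / besselK (((d : ℝ) + 1) / 2) z := by
    simp [G, sub_eq_add_neg]
  rw [hG]
  generalize besselK (((d : ℝ) + 1) / 2) z = k at *
  generalize besselK (((d : ℝ) + 1) / 2 - 1) z = m at *
  generalize besselK (((d : ℝ) + 1) / 2 + 1) z = p at *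
  have e : m / k + z * ((m / k) ^ 2 + d / z * (m / k) - 1) = z * (m * p - k ^ 2) / k ^ 2 := by
    field_simp
    linear_combination -m * hr
  rw [e]
  exact div_pos (mul_pos hz (sub_pos.2 hturan)) (by positivity)
end
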